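/- Assume the Jellium and Wiener conditions. Let r ∈ ℝ³ and κ : Γ_N → ℝ³, and set σ^{(1)}(x) := −∑_{n∈Γ_N} κ(n)·∇σ(x−n−r). If ∑_{ξ∈Γ*_N\{0}} |σ̂^{(1)}(ξ)|²/|ξ|² = 0, then κ is constant: there exists s ∈ ℝ³ with κ(n) = s for every n ∈ Γ_N. -/

import Mathlib

noncomputable section

namespace SPN

open MeasureTheory Finset
open scoped Real

/-- Points of `ℝ³`. -/
abbrev V3 : Type := Fin 3 → ℝ

/-- Euclidean dot product on `ℝ³`. -/
def dotP (v w : V3) : ℝ := ∑ i, v i * w i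

/-- Squared Euclidean norm on `ℝ³`. -/
def nsqV (v : V3) : ℝ := ∑ i, v i ^ 2

/-- The fundamental cube `[0,N)³` of the torus `T_N = ℝ³/(N·ℤ³)`. -/
def cubeN (N : ℕ) : Set V3 := {x | ∀ i, x i ∈ Set.Ico (0 : ℝ) (N : ℝ)}

/-- `N·ℤ³`-periodicity of a function on `ℝ³`. -/
def IsPerN {α : Type*} (N : ℕ) (f : V3 → α) : Prop :=
  ∀ (x : V3) (k : Fin 3 → ℤ), f (x + fun i => (N : ℝ) * (k i : ℝ)) = f x

/-- Index set for `Γ_N = {0,…,N−1}³`. -/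
abbrev GammaIdx (N : ℕ) : Type := Fin 3 → Fin N

/-- The lattice point of `Γ_N` associated to an index. -/
def embG {N : ℕ} (n : GammaIdx N) : V3 := fun i => ((n i : ℕ) : ℝ)

/-- Fourier coefficient `f̂(ξ) = ∫_{T_N} e^{iξ·x} f(x) dx`. -/
def fCoeff (N : ℕ) (f : V3 → ℂ) (ξ : V3) : ℂ :=
  ∫ x in cubeN N, Complex.exp (Complex.I * ((dotP ξ x : ℝ) : ℂ)) * f x

/-- Fourier coefficient of a real-valued function. -/
def fCoeffR (N : ℕ) (f : V3 → ℝ) (ξ : V3) : ℂ :=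
  fCoeff N (fun x => ((f x : ℝ) : ℂ)) ξ

/-- The point `(2π/N)·k` of the dual lattice `Γ*_N`. -/
def xiN (N : ℕ) (k : Fin 3 → ℤ) : V3 := fun i => (2 * π / (N : ℝ)) * (k i : ℝ)

/-- The Jellium condition: `σ̂(ξ) = 0` for all `ξ ∈ Γ*_1 \ {0}`. -/
def JelliumCond (N : ℕ) (σ : V3 → ℝ) : Prop :=
  ∀ k : Fin 3 → ℤ, k ≠ 0 → fCoeffR N σ (fun i => 2 * π * (k i : ℝ)) = 0

/-- `(2π/N)·k ∈ Γ*_1`, i.e. every coordinate of `k` is divisible by `N`. -/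
def inGamma1 (N : ℕ) (k : Fin 3 → ℤ) : Prop := ∀ i, (N : ℤ) ∣ k i

/-- `|∇φ(x)|²` for a complex-valued function. -/
def gradSq (φ : V3 → ℂ) (x : V3) : ℝ :=
  ∑ i, Complex.normSq (fderiv ℝ φ x (Pi.single i 1))

/-- Gradient of a real-valued function on `ℝ³`. -/
def gradV (f : V3 → ℝ) (x : V3) : V3 := fun i => fderiv ℝ f x (Pi.single i 1)

/-- Total charge density `ρ(x) = ∑_n σ(x−n−q(n)) − e|ψ(x)|²`. -/
def rhoT (N : ℕ) (σ : V3 → ℝ) (e : ℝ) (ψ : V3 → ℂ) (q : GammaIdx N → V3) (x : V3) : ℝ :=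
  (∑ n : GammaIdx N, σ (x - embG n - q n)) - e * Complex.normSq (ψ x)

/-- `∑_{ξ∈Γ*_N\{0}} |f̂(ξ)|²/|ξ|²`. -/
def dualSum (N : ℕ) (f : V3 → ℝ) : ℝ :=
  ∑' k : Fin 3 → ℤ, if k = 0 then 0 else
    Complex.normSq (fCoeffR N f (xiN N k)) / nsqV (xiN N k)

/-- The energy functional `E(ψ,q,p)`. -/
def energyE (N : ℕ) (σ : V3 → ℝ) (e M : ℝ) (ψ : V3 → ℂ) (q p : GammaIdx N → V3) : ℝ :=
  (1 / 2) * (∫ x in cubeN N, gradSq ψ x)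
    + (2 * (N : ℝ) ^ 3)⁻¹ * dualSum N (rhoT N σ e ψ q)
    + (2 * M)⁻¹ * ∑ n : GammaIdx N, nsqV (p n)

/-- The matrix `Σ(θ) = ∑_{m∈ℤ³} (ξξᵀ/|ξ|²)|σ̂(ξ)|²`, `ξ = θ + 2πm`. -/
def SigMat (N : ℕ) (σ : V3 → ℝ) (θ : V3) : Matrix (Fin 3) (Fin 3) ℝ :=
  Matrix.of fun a b => ∑' m : Fin 3 → ℤ,
    ((θ a + 2 * π * (m a : ℝ)) * (θ b + 2 * π * (m b : ℝ))
        / nsqV (fun i => θ i + 2 * π * (m i : ℝ)))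
      * Complex.normSq (fCoeffR N σ (fun i => θ i + 2 * π * (m i : ℝ)))

/-- The Wiener condition: `Σ(θ)` is positive definite for all `θ ∈ Γ*_N \ Γ*_1`. -/
def WienerCond (N : ℕ) (σ : V3 → ℝ) : Prop :=
  ∀ k : Fin 3 → ℤ, ¬ inGamma1 N k → (SigMat N σ (xiN N k)).PosDef

/-- First-order ionic density `σ⁽¹⁾(x) = −∑_n κ(n)·∇σ(x−n−r)`. -/
def sigma1F (N : ℕ) (σ : V3 → ℝ) (r : V3) (κ : GammaIdx N → V3) (x : V3) : ℝ :=
  - ∑ n : GammaIdx N, dotP (κ n) (gradV σ (x - embG n - r))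

/-- First-order charge density `ρ⁽¹⁾(x) = σ⁽¹⁾(x) − 2e√Z·Re(e^{−iα}φ(x))`. -/
def rho1F (N : ℕ) (σ : V3 → ℝ) (e Z α : ℝ) (r : V3) (κ : GammaIdx N → V3)
    (φ : V3 → ℂ) (x : V3) : ℝ :=
  sigma1F N σ r κ x - 2 * e * Real.sqrt Z * (Complex.exp (-Complex.I * (α : ℂ)) * φ x).re

/-- The quadratic form `B(φ,κ,p)` (half of the energy Hessian). -/
def BformQ (N : ℕ) (σ : V3 → ℝ) (e Z M α : ℝ) (r : V3)
    (φ : V3 → ℂ) (κ p : GammaIdx N → V3) : ℝ :=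
  (1 / 2) * (∫ x in cubeN N, gradSq φ x)
    + (2 * (N : ℝ) ^ 3)⁻¹ * dualSum N (rho1F N σ e Z α r κ φ)
    + (2 * M)⁻¹ * ∑ n : GammaIdx N, nsqV (p n)

/-- Second-order charge density `ρ⁽²⁾`. -/
def rho2F (N : ℕ) (σ : V3 → ℝ) (e : ℝ) (r : V3) (κ : GammaIdx N → V3)
    (φ : V3 → ℂ) (x : V3) : ℝ :=
  (∑ n : GammaIdx N,
      (σ (x - embG n - r - κ n) - σ (x - embG n - r)
        + dotP (κ n) (gradV σ (x - embG n - r))))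
    - e * Complex.normSq (φ x)

/-- The pairing `(f, Gg) = N⁻³ ∑_{ξ∈Γ*_N\{0}} Re(f̂(ξ)·conj(ĝ(ξ)))/|ξ|²`. -/
def GPair (N : ℕ) (f g : V3 → ℝ) : ℝ :=
  ((N : ℝ) ^ 3)⁻¹ * ∑' k : Fin 3 → ℤ, if k = 0 then 0 else
    (fCoeffR N f (xiN N k) * (starRingEnd ℂ) (fCoeffR N g (xiN N k))).re / nsqV (xiN N k)

/-- The distance to the solitary manifold of ground states. -/
def distS (N : ℕ) (Z : ℝ) (ψ : V3 → ℂ) (q p : GammaIdx N → V3) : ℝ :=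
  ⨅ (α : ℝ) (r : V3),
    (Real.sqrt (∫ x in cubeN N,
        (Complex.normSq (ψ x - Complex.exp (Complex.I * (α : ℂ)) * ((Real.sqrt Z : ℝ) : ℂ))
          + gradSq ψ x))
      + Real.sqrt (∑ n : GammaIdx N, ⨅ k : Fin 3 → ℤ,
          nsqV (fun i => q n i - r i - (N : ℝ) * (k i : ℝ)))
      + Real.sqrt (∑ n : GammaIdx N, nsqV (p n)))

/-- The discrete Fourier transform `κ̂(θ) ∈ ℂ³` of `κ : Γ_N → ℝ³`. -/
def hatK (N : ℕ) (κ : GammaIdx N → V3) (θ : V3) (a : Fin 3) : ℂ :=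
  ∑ n : GammaIdx N, Complex.exp (Complex.I * ((dotP θ (embG n) : ℝ) : ℂ)) * ((κ n a : ℝ) : ℂ)

/-- Laplacian of a complex-valued function on `ℝ³`. -/
def lapC (f : V3 → ℂ) (x : V3) : ℂ :=
  ∑ i, fderiv ℝ (fun y => fderiv ℝ f y (Pi.single i 1)) x (Pi.single i 1)

/-- Laplacian of a real-valued function on `ℝ³`. -/
def lapR (f : V3 → ℝ) (x : V3) : ℝ :=
  ∑ i, fderiv ℝ (fun y => fderiv ℝ f y (Pi.single i 1)) x (Pi.single i 1)

/-- A classical solution of the Schrödinger–Poisson–Newton system on `ℝ`. -/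
structure IsSPN (N : ℕ) (σ : V3 → ℝ) (e M : ℝ)
    (ψ : V3 → ℝ → ℂ) (Φ : V3 → ℝ → ℝ) (q : ℝ → GammaIdx N → V3) : Prop where
  per_psi : ∀ t : ℝ, IsPerN N (fun x => ψ x t)
  per_Phi : ∀ t : ℝ, IsPerN N (fun x => Φ x t)
  regx_psi : ∀ t : ℝ, ContDiff ℝ 2 (fun x => ψ x t)
  regt_psi : ∀ x : V3, ContDiff ℝ 1 (fun t => ψ x t)
  regx_Phi : ∀ t : ℝ, ContDiff ℝ 2 (fun x => Φ x t)
  regt_Phi : ∀ x : V3, ContDiff ℝ 1 (fun t => Φ x t)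
  reg_q : ContDiff ℝ 2 q
  schrodinger : ∀ (x : V3) (t : ℝ),
    Complex.I * deriv (fun s => ψ x s) t =
      -(1 / 2 : ℂ) * lapC (fun y => ψ y t) x - ((e : ℝ) : ℂ) * ((Φ x t : ℝ) : ℂ) * ψ x t
  poisson : ∀ (x : V3) (t : ℝ),
    - lapR (fun y => Φ y t) x =
      (∑ n : GammaIdx N, σ (x - embG n - q t n)) - e * Complex.normSq (ψ x t)
  newton : ∀ (n : GammaIdx N) (t : ℝ) (i : Fin 3),
    M * deriv (fun s => deriv (fun u => q u n i) s) t =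
      - ∫ x in cubeN N, fderiv ℝ (fun y => Φ y t) x (Pi.single i 1) * σ (x - embG n - q t n)


def latHom (N : ℕ) : (Fin 3 → ℤ) →+ V3 where
  toFun k := fun i => (N : ℝ) * (k i : ℝ)
  map_zero' := by ext; simp
  map_add' a b := by ext; simp [mul_add]

lemma measurableSet_cubeN (N : ℕ) : MeasurableSet (cubeN N) := by
  have : cubeN N = Set.univ.pi (fun _ => Set.Ico (0 : ℝ) (N : ℝ)) := by
    ext x; simp [cubeN]
  rw [this]
  exact MeasurableSet.univ_pi fun _ => measurableSet_Ico

lemma cubeN_ae (N : ℕ) : cubeN N =ᵐ[volume] Set.Icc (0 : V3) (fun _ => (N : ℝ)) := by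
  have : cubeN N = Set.univ.pi (fun i : Fin 3 => Set.Ico ((0 : V3) i) ((fun _ => (N : ℝ)) i)) := by
    ext x; simp [cubeN]
  rw [this]
  exact Measure.univ_pi_Ico_ae_eq_Icc

lemma fundDom (N : ℕ) (hN : 0 < N) :
    IsAddFundamentalDomain (latHom N).range (cubeN N) (volume : Measure V3) := by
  have hN' : (0 : ℝ) < N := by exact_mod_cast hN
  refine IsAddFundamentalDomain.mk' (measurableSet_cubeN N).nullMeasurableSet fun x => ?_
  have h := fun i => existsUnique_add_zsmul_mem_Ico hN' (x i) 0
  choose k hk hu using h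
  refine ⟨⟨latHom N k, k, rfl⟩, ?_, ?_⟩
  · intro i
    have := hk i
    simp only [zsmul_eq_mul, zero_add] at this
    change (N : ℝ) * (k i : ℝ) + x i ∈ _
    rwa [add_comm, mul_comm]
  · rintro ⟨_, k', rfl⟩ h
    have : k' = k := by
      ext i
      refine hu i (k' i) ?_
      have := h i
      change (N : ℝ) * (k' i : ℝ) + x i ∈ _ at this
      simp only [zsmul_eq_mul, zero_add]
      rwa [add_comm, mul_comm] at this
    subst this; rfl

lemma shift_int (N : ℕ) (hN : 0 < N) (g : V3 → ℂ) (hg : IsPerN N g) (a : V3) :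
    ∫ x in cubeN N, g (x - a) = ∫ x in cubeN N, g x := by
  have h1 := fundDom N hN
  have : Countable (latHom N).range := (Set.countable_range (latHom N)).to_subtype
  have h2 := h1.vadd_of_comm a
  have h3 := h1.setIntegral_eq h2 (f := fun x => g (x - a)) (by
    rintro ⟨_, k, rfl⟩ x
    change g ((latHom N k) + x - a) = _
    rw [show (latHom N k) + x - a = (x - a) + latHom N k by abel]
    exact hg _ k)
  rw [h3]
  have := (measurePreserving_vadd a (volume : Measure V3)).setIntegral_image_emb
    (measurableEmbedding_const_vadd a) (fun x => g (x - a)) (cubeN N)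
  refine (Eq.trans ?_ this).trans ?_
  · rfl
  · simp

lemma integrableOn_cube (N : ℕ) {E : Type*} [NormedAddCommGroup E] (g : V3 → E) (hg : Continuous g) :
    IntegrableOn g (cubeN N) := by
  refine (hg.continuousOn.integrableOn_compact (isCompact_Icc (a := (0 : V3))
    (b := fun _ => (N : ℝ)))).mono_set ?_
  intro x hx
  exact ⟨fun i => (hx i).1, fun i => (hx i).2.le⟩

lemma deriv_int (N : ℕ) (g : V3 → ℂ) (hg : IsPerN N g) (hd : ContDiff ℝ 1 g) (j : Fin 3) :
    ∫ x in cubeN N, fderiv ℝ g x (Pi.single j 1) = 0 := by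
  rw [setIntegral_congr_set (cubeN_ae N)]
  have hc : Continuous fun x => fderiv ℝ g x (Pi.single j 1) :=
    (hd.continuous_fderiv (by norm_num)).clm_apply continuous_const
  have hsum : ∀ x : V3, (∑ i, (if i = j then fderiv ℝ g x else 0) (Pi.single i 1))
      = fderiv ℝ g x (Pi.single j 1) := by
    intro x
    rw [Finset.sum_eq_single j] <;> simp +contextual
  have := integral_divergence_of_hasFDerivAt_off_countable' (n := 2) (0 : V3) (fun _ => (N : ℝ))
    (fun i => by simp) (fun i x => if i = j then g x else 0)
    (fun i x => if i = j then fderiv ℝ g x else 0) ∅ Set.countable_empty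
    (fun i => by
      by_cases h : i = j
      · simpa [h] using hd.continuous.continuousOn
      · simpa [h] using continuousOn_const)
    (fun x _ i => by
      by_cases h : i = j
      · simpa [h] using (hd.differentiable (by norm_num) x).hasFDerivAt
      · simpa [h] using hasFDerivAt_const (0:ℂ) x)
    (by
      simp only [hsum]
      exact hc.continuousOn.integrableOn_compact isCompact_Icc)
  simp only [hsum] at this
  rw [this]
  refine Finset.sum_eq_zero fun i _ => ?_
  rw [sub_eq_zero]
  congr 1
  ext y
  by_cases h : i = j
  · subst h
    simp only [if_true]
    have := hg (i.insertNth ((0 : V3) i) y) (Pi.single i 1)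
    rw [← this]
    congr 1
    ext l
    refine Fin.succAboveCases i ?_ (fun m => ?_) l
    · simp
    · simp
  · simp [h]

/-- the character -/
def Ech (N : ℕ) (k : Fin 3 → ℤ) (x : V3) : ℂ :=
  Complex.exp (Complex.I * ((dotP (xiN N k) x : ℝ) : ℂ))

lemma dotP_add (a x y : V3) : dotP a (x + y) = dotP a x + dotP a y := by
  simp [dotP, mul_add, Finset.sum_add_distrib]

lemma Ech_add (N : ℕ) (k : Fin 3 → ℤ) (x y : V3) : Ech N k (x + y) = Ech N k x * Ech N k y := by
  simp only [Ech, dotP_add, ← Complex.exp_add]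
  congr 1; push_cast; ring

lemma Ech_lat (N : ℕ) (hN : 0 < N) (k m : Fin 3 → ℤ) :
    Ech N k (fun i => (N : ℝ) * (m i : ℝ)) = 1 := by
  have hN' : (N : ℝ) ≠ 0 := by positivity
  rw [Ech, Complex.exp_eq_one_iff]
  refine ⟨∑ i, k i * m i, ?_⟩
  have : dotP (xiN N k) (fun i => (N : ℝ) * (m i : ℝ)) = 2 * π * (∑ i, k i * m i : ℤ) := by
    simp only [dotP, xiN]
    push_cast
    rw [Finset.mul_sum]
    refine Finset.sum_congr rfl fun i _ => ?_
    field_simp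
  rw [this]; push_cast; ring

lemma Ech_per (N : ℕ) (hN : 0 < N) (k : Fin 3 → ℤ) : IsPerN N (Ech N k) := by
  intro x m
  rw [Ech_add, Ech_lat N hN, mul_one]

lemma dotP_contDiff (a : V3) : ContDiff ℝ 2 (dotP a) := by
  unfold dotP; fun_prop

lemma Ech_contDiff (N : ℕ) (k : Fin 3 → ℤ) : ContDiff ℝ 2 (Ech N k) := by
  unfold Ech
  have h1 := dotP_contDiff (xiN N k)
  have h2 : ContDiff ℝ 2 fun x => ((dotP (xiN N k) x : ℝ) : ℂ) :=
    Complex.ofRealCLM.contDiff.comp h1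
  exact (contDiff_const.mul h2).cexp

lemma Ech_fderiv (N : ℕ) (k : Fin 3 → ℤ) (x : V3) (j : Fin 3) :
    fderiv ℝ (Ech N k) x (Pi.single j 1) = Complex.I * (xiN N k j : ℝ) * Ech N k x := by
  have hd : DifferentiableAt ℝ (Ech N k) x := (Ech_contDiff N k).differentiable (by norm_num) x
  rw [← hd.lineDeriv_eq_fderiv]
  have : HasLineDerivAt ℝ (Ech N k) (Complex.I * (xiN N k j : ℝ) * Ech N k x) x (Pi.single j 1) := by
    unfold HasLineDerivAt
    have e : (fun t : ℝ => Ech N k (x + t • Pi.single j 1)) =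
        fun t : ℝ => Ech N k x * Complex.exp (Complex.I * (xiN N k j : ℝ) * (t : ℂ)) := by
      ext t
      rw [Ech_add]
      congr 1
      rw [Ech]
      congr 1
      have : dotP (xiN N k) (t • Pi.single j 1) = xiN N k j * t := by
        simp [dotP, Pi.single_apply]
      rw [this]; push_cast; ring
    rw [e]
    have h0 : HasDerivAt (fun t : ℝ => Complex.I * (xiN N k j : ℝ) * (t : ℂ))
        (Complex.I * (xiN N k j : ℝ)) 0 := by
      simpa using (Complex.ofRealCLM.hasDerivAt (x := (0:ℝ))).const_mul (Complex.I * (xiN N k j : ℝ) : ℂ)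
    have h1 := (h0.cexp).const_mul (Ech N k x)
    have hv : Ech N k x * (Complex.exp (Complex.I * (xiN N k j : ℝ) * ((0 : ℝ) : ℂ)) *
        (Complex.I * (xiN N k j : ℝ))) = Complex.I * (xiN N k j : ℝ) * Ech N k x := by
      rw [Complex.ofReal_zero, mul_zero, Complex.exp_zero]; ring
    rw [hv] at h1
    exact h1
  exact this.lineDeriv

lemma grad_coeff (N : ℕ) (hN : 0 < N) (σ : V3 → ℝ) (hper : IsPerN N σ) (hreg : ContDiff ℝ 2 σ)
    (k : Fin 3 → ℤ) (j : Fin 3) :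
    fCoeffR N (fun x => gradV σ x j) (xiN N k) =
      - Complex.I * (xiN N k j : ℝ) * fCoeffR N σ (xiN N k) := by
  have hs : ContDiff ℝ 2 fun x => ((σ x : ℝ) : ℂ) := Complex.ofRealCLM.contDiff.comp hreg
  have h := deriv_int N (fun x => Ech N k x * (σ x : ℂ)) (by
    intro x m
    change Ech N k _ * ((σ _ : ℝ) : ℂ) = _
    rw [hper x m, Ech_per N hN k x m]) (((Ech_contDiff N k).mul hs).of_le (by norm_num)) j
  have e : ∀ x, fderiv ℝ (fun x => Ech N k x * (σ x : ℂ)) x (Pi.single j 1) =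
      Ech N k x * (gradV σ x j : ℝ) +
        Complex.I * (xiN N k j : ℝ) * (Ech N k x * (σ x : ℂ)) := by
    intro x
    have hd1 : DifferentiableAt ℝ (Ech N k) x := (Ech_contDiff N k).differentiable (by norm_num) x
    have hd2 : DifferentiableAt ℝ (fun x => ((σ x : ℝ) : ℂ)) x := hs.differentiable (by norm_num) x
    have hd3 : DifferentiableAt ℝ σ x := hreg.differentiable (by norm_num) x
    have h3 : fderiv ℝ (fun x => ((σ x : ℝ) : ℂ)) x = Complex.ofRealCLM.comp (fderiv ℝ σ x) :=
      (Complex.ofRealCLM.hasFDerivAt.comp x hd3.hasFDerivAt).fderiv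
    rw [fderiv_fun_mul hd1 hd2, h3]
    simp [gradV, Ech_fderiv]
    ring
  have hgc : Continuous fun x => gradV σ x j :=
    (hreg.continuous_fderiv (by norm_num)).clm_apply continuous_const
  have hEc := (Ech_contDiff N k).continuous
  simp only [e] at h
  have i1 : IntegrableOn (fun x => Ech N k x * (gradV σ x j : ℝ)) (cubeN N) :=
    integrableOn_cube N _ (hEc.mul (Complex.continuous_ofReal.comp hgc))
  have i2 : IntegrableOn (fun x => Complex.I * (xiN N k j : ℝ) * (Ech N k x * (σ x : ℂ))) (cubeN N) :=
    integrableOn_cube N _ (continuous_const.mul (hEc.mul hs.continuous))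
  rw [integral_add i1 i2, integral_const_mul] at h
  simp only [fCoeffR, fCoeff]
  simp only [Ech] at h
  linear_combination h

lemma shift_coeff (N : ℕ) (hN : 0 < N) (f : V3 → ℝ) (hf : IsPerN N f) (k : Fin 3 → ℤ) (a : V3) :
    fCoeffR N (fun x => f (x - a)) (xiN N k) = Ech N k a * fCoeffR N f (xiN N k) := by
  have h := shift_int N hN (fun x => Ech N k x * (f x : ℂ)) (by
    intro x m
    simp only [hf x m, Ech_per N hN k x m]) a
  simp only [fCoeffR, fCoeff]
  change _ = Ech N k a * ∫ x in cubeN N, Ech N k x * (f x : ℂ)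
  rw [← h, ← integral_const_mul]
  congr 1
  ext x
  rw [← mul_assoc, ← Ech_add, add_sub_cancel]
  rfl

lemma gradV_per (N : ℕ) (σ : V3 → ℝ) (hper : IsPerN N σ) (j : Fin 3) :
    IsPerN N (fun x => gradV σ x j) := by
  intro x m
  simp only [gradV]
  rw [← fderiv_comp_add_right]
  congr 2
  ext y
  exact hper y m

lemma gradV_cont (σ : V3 → ℝ) (hreg : ContDiff ℝ 2 σ) (j : Fin 3) :
    Continuous fun x => gradV σ x j :=
  (hreg.continuous_fderiv (by norm_num)).clm_apply continuous_const

lemma sigma1F_cont (N : ℕ) (σ : V3 → ℝ) (hreg : ContDiff ℝ 2 σ) (r : V3) (κ : GammaIdx N → V3) :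
    Continuous (sigma1F N σ r κ) := by
  unfold sigma1F dotP
  refine (continuous_finsetSum _ fun n _ => continuous_finsetSum _ fun a _ => ?_).neg
  exact continuous_const.mul ((gradV_cont σ hreg a).comp (by fun_prop))

lemma sigma1_coeff (N : ℕ) (hN : 0 < N) (σ : V3 → ℝ) (hper : IsPerN N σ) (hreg : ContDiff ℝ 2 σ)
    (r : V3) (κ : GammaIdx N → V3) (k : Fin 3 → ℤ) :
    fCoeffR N (sigma1F N σ r κ) (xiN N k) =
      Complex.I * Ech N k r * fCoeffR N σ (xiN N k) *
        ∑ a, (xiN N k a : ℝ) * hatK N κ (xiN N k) a := by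
  have hEc := (Ech_contDiff N k).continuous
  have key : ∀ (n : GammaIdx N) (a : Fin 3),
      ∫ x in cubeN N, Ech N k x * ((gradV σ (x - embG n - r) a : ℝ) : ℂ) =
        Ech N k (embG n) * Ech N k r *
          (- Complex.I * (xiN N k a : ℝ) * fCoeffR N σ (xiN N k)) := by
    intro n a
    rw [← grad_coeff N hN σ hper hreg, ← Ech_add,
      ← shift_coeff N hN _ (gradV_per N σ hper a) k (embG n + r)]
    simp only [fCoeffR, fCoeff, sub_sub]
    rfl
  have e : ∀ x, Ech N k x * ((sigma1F N σ r κ x : ℝ) : ℂ) =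
      ∑ n : GammaIdx N, ∑ a : Fin 3,
        (-(κ n a : ℝ) : ℂ) * (Ech N k x * ((gradV σ (x - embG n - r) a : ℝ) : ℂ)) := by
    intro x
    simp only [sigma1F, dotP]
    push_cast
    rw [← Finset.sum_neg_distrib, Finset.mul_sum]
    refine Finset.sum_congr rfl fun n _ => ?_
    rw [← Finset.sum_neg_distrib, Finset.mul_sum]
    refine Finset.sum_congr rfl fun a _ => ?_
    ring
  have hi : ∀ (n : GammaIdx N) (a : Fin 3), IntegrableOn (fun x =>
      (-(κ n a : ℝ) : ℂ) * (Ech N k x * ((gradV σ (x - embG n - r) a : ℝ) : ℂ))) (cubeN N) := by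
    intro n a
    refine integrableOn_cube N _ (continuous_const.mul (hEc.mul
      (Complex.continuous_ofReal.comp ?_)))
    exact (gradV_cont σ hreg a).comp (by fun_prop : Continuous fun x : V3 => x - embG n - r)
  have h1 : fCoeffR N (sigma1F N σ r κ) (xiN N k) =
      ∫ x in cubeN N, Ech N k x * ((sigma1F N σ r κ x : ℝ) : ℂ) := rfl
  rw [h1]
  simp only [e]
  rw [integral_finsetSum _ (fun n _ => integrable_finsetSum _ fun a _ => hi n a)]
  simp only [hatK, Finset.mul_sum]
  rw [Finset.sum_comm]
  refine Finset.sum_congr rfl fun n _ => ?_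
  rw [integral_finsetSum _ (fun a _ => hi n a)]
  refine Finset.sum_congr rfl fun a _ => ?_
  rw [integral_const_mul, key]
  simp only [Ech]
  ring

lemma int1d (N : ℕ) (hN : 0 < N) (m : ℤ) (hm : m ≠ 0) :
    ∫ t in Set.Ico (0:ℝ) N, Complex.exp (Complex.I * (((2 * π / (N : ℝ)) * (m : ℝ) * t : ℝ) : ℂ)) = 0 := by
  have hN' : (N : ℂ) ≠ 0 := by exact_mod_cast hN.ne'
  have hm' : (m : ℂ) ≠ 0 := by exact_mod_cast hm
  have hpi : (π : ℂ) ≠ 0 := by exact_mod_cast Real.pi_ne_zero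
  rw [integral_Ico_eq_integral_Ioc, ← intervalIntegral.integral_of_le (by positivity)]
  have hc : (Complex.I * (2 * π / N) * m : ℂ) ≠ 0 := by
    exact mul_ne_zero (mul_ne_zero Complex.I_ne_zero
      (div_ne_zero (mul_ne_zero two_ne_zero hpi) hN')) hm'
  have := integral_exp_mul_complex (a := 0) (b := N) hc
  have e : (fun t : ℝ => Complex.exp (Complex.I * (((2 * π / (N : ℝ)) * (m : ℝ) * t : ℝ) : ℂ))) =
      fun t : ℝ => Complex.exp (Complex.I * (2 * π / N) * m * t) := by
    ext t; congr 1; push_cast; ring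
  rw [e, this]
  have h2 : Complex.exp (Complex.I * (2 * π / N) * m * (N : ℝ)) = 1 := by
    rw [Complex.exp_eq_one_iff]
    refine ⟨m, ?_⟩
    push_cast
    field_simp
  rw [h2]; simp

lemma Ech_prod (N : ℕ) (k : Fin 3 → ℤ) (x : V3) : Ech N k x =
    ∏ i, Complex.exp (Complex.I * (((2 * π / (N : ℝ)) * (k i : ℝ) * x i : ℝ) : ℂ)) := by
  rw [← Complex.exp_sum, Ech]
  congr 1
  simp only [dotP, xiN]
  push_cast
  rw [Finset.mul_sum]

lemma int_Ech (N : ℕ) (hN : 0 < N) (k : Fin 3 → ℤ) (hk : k ≠ 0) :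
    ∫ x in cubeN N, Ech N k x = 0 := by
  have : cubeN N = Set.univ.pi (fun _ => Set.Ico (0 : ℝ) (N : ℝ)) := by
    ext x; simp [cubeN]
  rw [this, volume_pi, Measure.restrict_pi_pi]
  simp only [Ech_prod]
  rw [integral_fintype_prod_eq_prod (fun i (t : ℝ) =>
    Complex.exp (Complex.I * (((2 * π / (N : ℝ)) * (k i : ℝ) * t : ℝ) : ℂ)))]
  obtain ⟨i, hi⟩ := Function.ne_iff.mp hk
  exact Finset.prod_eq_zero (Finset.mem_univ i) (int1d N hN _ hi)

lemma Ech_neg (N : ℕ) (k : Fin 3 → ℤ) (x : V3) : (starRingEnd ℂ) (Ech N k x) = Ech N (-k) x := by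
  simp only [Ech, ← Complex.exp_conj]
  congr 1
  rw [map_mul, Complex.conj_I, Complex.conj_ofReal]
  simp [dotP, xiN]

lemma Ech_mul (N : ℕ) (k l : Fin 3 → ℤ) (x : V3) : Ech N k x * Ech N l x = Ech N (k + l) x := by
  simp only [Ech, ← Complex.exp_add]
  congr 1
  simp only [dotP, xiN, Pi.add_apply]
  push_cast
  rw [← mul_add, ← Finset.sum_add_distrib]
  congr 1
  refine Finset.sum_congr rfl fun i _ => ?_
  ring

lemma Ech_norm (N : ℕ) (k : Fin 3 → ℤ) (x : V3) : ‖Ech N k x‖ = 1 := by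
  rw [Ech, mul_comm, Complex.norm_exp_ofReal_mul_I]

instance (N : ℕ) : IsFiniteMeasure ((volume : Measure V3).restrict (cubeN N)) := by
  have h := integrableOn_cube N (fun _ => (1 : ℝ)) continuous_const
  have := (integrableOn_const_iff (C := (1:ℝ)) (by simp)).1 h
  constructor
  simpa using this

lemma vol_cube_pos (N : ℕ) (hN : 0 < N) : 0 < (volume : Measure V3).real (cubeN N) := by
  have : cubeN N = Set.univ.pi (fun _ => Set.Ico (0 : ℝ) (N : ℝ)) := by
    ext x; simp [cubeN]
  rw [this, measureReal_def, volume_pi, Measure.pi_pi]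
  simp
  positivity

lemma memLp_Ech (N : ℕ) (k : Fin 3 → ℤ) :
    MemLp (Ech N k) 2 ((volume : Measure V3).restrict (cubeN N)) :=
  MemLp.of_bound (Ech_contDiff N k).continuous.aestronglyMeasurable 1
    (Filter.Eventually.of_forall fun x => (Ech_norm N k x).le)

lemma memLp_cont (N : ℕ) (f : V3 → ℂ) (hf : Continuous f) :
    MemLp f 2 ((volume : Measure V3).restrict (cubeN N)) := by
  obtain ⟨C, hC⟩ := (isCompact_Icc (a := (0 : V3)) (b := fun _ => (N : ℝ))).exists_bound_of_continuousOn
    hf.continuousOn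
  refine MemLp.of_bound hf.aestronglyMeasurable C ?_
  filter_upwards [ae_restrict_mem (measurableSet_cubeN N)] with x hx
  exact hC x ⟨fun i => (hx i).1, fun i => (hx i).2.le⟩

lemma inner_toLp {N : ℕ} {f g : V3 → ℂ} (hf : MemLp f 2 ((volume : Measure V3).restrict (cubeN N)))
    (hg : MemLp g 2 ((volume : Measure V3).restrict (cubeN N))) :
    inner ℂ (hf.toLp f) (hg.toLp g) = ∫ x in cubeN N, (starRingEnd ℂ) (f x) * g x := by
  rw [MeasureTheory.L2.inner_def]
  refine integral_congr_ae ?_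
  filter_upwards [hf.coeFn_toLp, hg.coeFn_toLp] with x h1 h2
  rw [h1, h2, RCLike.inner_apply, mul_comm]

lemma bessel (N : ℕ) (hN : 0 < N) (f : V3 → ℝ) (hf : Continuous f) :
    Summable fun k : Fin 3 → ℤ => Complex.normSq (fCoeffR N f (xiN N k)) := by
  set V := (volume : Measure V3).real (cubeN N) with hV
  have hVpos : 0 < V := vol_cube_pos N hN
  set c : ℝ := (Real.sqrt V)⁻¹ with hc
  have hcc : c * c * V = 1 := by
    rw [hc, ← mul_inv, Real.mul_self_sqrt hVpos.le, inv_mul_cancel₀ hVpos.ne']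
  let v : (Fin 3 → ℤ) → Lp ℂ 2 ((volume : Measure V3).restrict (cubeN N)) :=
    fun k => (c : ℂ) • (memLp_Ech N (-k)).toLp
  have hv : Orthonormal ℂ v := by
    rw [orthonormal_iff_ite]
    intro k l
    simp only [v, inner_smul_left, inner_smul_right, inner_toLp, Ech_neg, Ech_mul, Complex.conj_ofReal]
    split_ifs with h
    · subst h
      have : ∀ x, Ech N (- -k + -k) x = 1 := by
        intro x; simp [Ech, dotP, xiN]
      simp only [this]
      rw [setIntegral_const, ← hV]
      rw [← mul_assoc]
      simp only [Complex.real_smul, mul_one]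
      exact_mod_cast hcc
    · rw [int_Ech N hN _ (by rwa [neg_neg, ← sub_eq_add_neg, sub_ne_zero])]
      simp
  have hF := memLp_cont N (fun x => (f x : ℂ)) (Complex.continuous_ofReal.comp hf)
  have h := hv.inner_products_summable (x := hF.toLp)
  have e : ∀ k, Complex.normSq (fCoeffR N f (xiN N k)) = V * ‖inner ℂ (v k) hF.toLp‖ ^ 2 := by
    intro k
    simp only [v, inner_smul_left, inner_toLp, Ech_neg, Complex.conj_ofReal, neg_neg]
    rw [norm_mul, mul_pow]
    have : ‖(c : ℂ)‖ ^ 2 = c * c := by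
      rw [Complex.norm_real, Real.norm_eq_abs, sq_abs, sq]
    rw [this, Complex.normSq_eq_norm_sq]
    change ‖∫ x in cubeN N, Ech N k x * (f x : ℂ)‖ ^ 2 = _
    linear_combination (-‖∫ x in cubeN N, Ech N k x * (f x : ℂ)‖ ^ 2) * hcc
  simp only [e]
  exact h.mul_left V

lemma nsqV_lower (N : ℕ) (k : Fin 3 → ℤ) (hk : k ≠ 0) :
    (2 * π / (N : ℝ)) ^ 2 ≤ nsqV (xiN N k) := by
  obtain ⟨i, hi⟩ := Function.ne_iff.mp hk
  have h1 : (xiN N k i) ^ 2 ≤ nsqV (xiN N k) :=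
    Finset.single_le_sum (f := fun i => (xiN N k i) ^ 2) (fun _ _ => sq_nonneg _) (Finset.mem_univ i)
  refine le_trans ?_ h1
  simp only [xiN, mul_pow]
  have : (1 : ℝ) ≤ (k i : ℝ) ^ 2 := by
    have h2 : (1 : ℤ) ≤ (k i) ^ 2 := by
      have : k i ≠ 0 := hi
      have := sq_pos_of_ne_zero this
      omega
    exact_mod_cast h2
  exact le_mul_of_one_le_right (sq_nonneg _) this

lemma coeff_zero (N : ℕ) (hN : 0 < N) (f : V3 → ℝ) (hf : Continuous f) (h0 : dualSum N f = 0)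
    (k : Fin 3 → ℤ) (hk : k ≠ 0) : fCoeffR N f (xiN N k) = 0 := by
  have hN' : (0 : ℝ) < N := by exact_mod_cast hN
  have hcpos : 0 < (2 * π / (N : ℝ)) ^ 2 := by positivity
  have hnn : ∀ k : Fin 3 → ℤ, 0 ≤ (if k = 0 then 0 else
      Complex.normSq (fCoeffR N f (xiN N k)) / nsqV (xiN N k)) := by
    intro k
    split_ifs with h
    · exact le_rfl
    · exact div_nonneg (Complex.normSq_nonneg _) (hcpos.le.trans (nsqV_lower N k h))
  have hs : Summable fun k : Fin 3 → ℤ => (if k = 0 then 0 else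
      Complex.normSq (fCoeffR N f (xiN N k)) / nsqV (xiN N k)) := by
    refine Summable.of_nonneg_of_le hnn (fun k => ?_)
      ((bessel N hN f hf).mul_right ((2 * π / (N : ℝ)) ^ 2)⁻¹)
    split_ifs with h
    · exact mul_nonneg (Complex.normSq_nonneg _) (inv_nonneg.2 hcpos.le)
    · rw [div_eq_mul_inv]
      exact mul_le_mul_of_nonneg_left (inv_anti₀ hcpos (nsqV_lower N k h)) (Complex.normSq_nonneg _)
  have h1 := (hasSum_zero_iff_of_nonneg hnn).1 (by
    have := hs.hasSum
    rwa [show (∑' k : Fin 3 → ℤ, if k = 0 then 0 else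
      Complex.normSq (fCoeffR N f (xiN N k)) / nsqV (xiN N k)) = 0 from h0] at this)
  have h2 := congrFun h1 k
  simp only [hk, if_false, Pi.zero_apply, div_eq_zero_iff] at h2
  rcases h2 with h2 | h2
  · exact Complex.normSq_eq_zero.1 h2
  · exact absurd h2 (hcpos.trans_le (nsqV_lower N k hk)).ne'

lemma xiN_shift (N : ℕ) (hN : 0 < N) (k m : Fin 3 → ℤ) :
    (fun i => xiN N k i + 2 * π * (m i : ℝ)) = xiN N (k + (N : ℤ) • m) := by
  have hN' : (N : ℝ) ≠ 0 := by exact_mod_cast hN.ne'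
  ext i
  simp only [xiN, Pi.add_apply, Pi.smul_apply, smul_eq_mul]
  push_cast
  field_simp

lemma Ech_embG (N : ℕ) (hN : 0 < N) (k m : Fin 3 → ℤ) (n : GammaIdx N) :
    Ech N (k + (N : ℤ) • m) (embG n) = Ech N k (embG n) := by
  have hN' : (N : ℂ) ≠ 0 := by exact_mod_cast hN.ne'
  rw [← Ech_mul]
  have : Ech N ((N : ℤ) • m) (embG n) = 1 := by
    rw [Ech, Complex.exp_eq_one_iff]
    refine ⟨∑ i, m i * ((n i : ℕ) : ℤ), ?_⟩
    simp only [dotP, xiN, embG, Pi.smul_apply, smul_eq_mul]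
    push_cast
    rw [Finset.mul_sum, Finset.sum_mul]
    refine Finset.sum_congr rfl fun i _ => ?_
    field_simp
  rw [this, mul_one]

lemma hatK_shift (N : ℕ) (hN : 0 < N) (κ : GammaIdx N → V3) (k m : Fin 3 → ℤ) (a : Fin 3) :
    hatK N κ (xiN N (k + (N : ℤ) • m)) a = hatK N κ (xiN N k) a := by
  unfold hatK
  refine Finset.sum_congr rfl fun n _ => ?_
  have := Ech_embG N hN k m n
  simp only [Ech] at this
  rw [this]

lemma wiener_zero (N : ℕ) (hN : 0 < N) (σ : V3 → ℝ) (hσ : Continuous σ) (hW : WienerCond N σ)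
    (k : Fin 3 → ℤ) (hk : ¬ inGamma1 N k) (w : V3)
    (hw : ∀ m : Fin 3 → ℤ, (∑ a, xiN N (k + (N : ℤ) • m) a * w a) *
      Complex.normSq (fCoeffR N σ (xiN N (k + (N : ℤ) • m))) = 0) : w = 0 := by
  by_contra hne
  have hpos := (hW k hk).dotProduct_mulVec_pos hne
  have hinj : Function.Injective fun m : Fin 3 → ℤ => k + (N : ℤ) • m := by
    intro m m' h
    have h' := add_left_cancel h
    ext i
    have := congrFun h' i
    simp only [Pi.smul_apply, smul_eq_mul] at this
    exact mul_left_cancel₀ (by exact_mod_cast hN.ne') this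
  have hb := (bessel N hN σ hσ).comp_injective hinj
  have hS : ∀ a b : Fin 3, Summable fun m : Fin 3 → ℤ =>
      (xiN N (k + (N : ℤ) • m) a * xiN N (k + (N : ℤ) • m) b / nsqV (xiN N (k + (N : ℤ) • m)))
        * Complex.normSq (fCoeffR N σ (xiN N (k + (N : ℤ) • m))) := by
    intro a b
    refine Summable.of_norm_bounded hb fun m => ?_
    rw [norm_mul, Real.norm_of_nonneg (Complex.normSq_nonneg _)]
    refine mul_le_of_le_one_left (Complex.normSq_nonneg _) ?_
    generalize xiN N (k + (N : ℤ) • m) = ξ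
    have hn : 0 ≤ nsqV ξ := Finset.sum_nonneg fun _ _ => sq_nonneg _
    rw [norm_div, Real.norm_of_nonneg hn]
    refine div_le_one_of_le₀ ?_ hn
    have h1 : ξ a ^ 2 ≤ nsqV ξ :=
      Finset.single_le_sum (f := fun i => ξ i ^ 2) (fun _ _ => sq_nonneg _) (Finset.mem_univ a)
    have h2 : ξ b ^ 2 ≤ nsqV ξ :=
      Finset.single_le_sum (f := fun i => ξ i ^ 2) (fun _ _ => sq_nonneg _) (Finset.mem_univ b)
    rw [Real.norm_eq_abs, abs_le]
    constructor
    · nlinarith [sq_nonneg (ξ a + ξ b)]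
    · nlinarith [sq_nonneg (ξ a - ξ b)]
  have hM : ∀ a b, SigMat N σ (xiN N k) a b = ∑' m : Fin 3 → ℤ,
      (xiN N (k + (N : ℤ) • m) a * xiN N (k + (N : ℤ) • m) b / nsqV (xiN N (k + (N : ℤ) • m)))
        * Complex.normSq (fCoeffR N σ (xiN N (k + (N : ℤ) • m))) := by
    intro a b
    simp only [SigMat, Matrix.of_apply]
    refine tsum_congr fun m => ?_
    rw [← xiN_shift N hN k m]
  have hsum : HasSum (fun m : Fin 3 → ℤ => ∑ a, ∑ b, w a *
      (((xiN N (k + (N : ℤ) • m) a * xiN N (k + (N : ℤ) • m) b / nsqV (xiN N (k + (N : ℤ) • m)))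
        * Complex.normSq (fCoeffR N σ (xiN N (k + (N : ℤ) • m)))) * w b))
      (∑ a, ∑ b, w a * (SigMat N σ (xiN N k) a b * w b)) := by
    refine hasSum_sum fun a _ => hasSum_sum fun b _ => ?_
    rw [hM]
    exact ((hS a b).hasSum.mul_right _).mul_left _
  have hz : ∀ m : Fin 3 → ℤ, (∑ a, ∑ b, w a *
      (((xiN N (k + (N : ℤ) • m) a * xiN N (k + (N : ℤ) • m) b / nsqV (xiN N (k + (N : ℤ) • m)))
        * Complex.normSq (fCoeffR N σ (xiN N (k + (N : ℤ) • m)))) * w b)) = 0 := by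
    intro m
    have h := hw m
    generalize xiN N (k + (N : ℤ) • m) = ξ at h ⊢
    have : (∑ a, ∑ b, w a *
      (((ξ a * ξ b / nsqV ξ) * Complex.normSq (fCoeffR N σ ξ)) * w b)) =
      (∑ a, ξ a * w a) / nsqV ξ * ((∑ a, ξ a * w a) * Complex.normSq (fCoeffR N σ ξ)) := by
      simp only [Fin.sum_univ_three]
      ring
    rw [this, h, mul_zero]
  simp only [hz] at hsum
  have h3 := hsum.unique hasSum_zero
  have h4 : star w ⬝ᵥ Matrix.mulVec (SigMat N σ (xiN N k)) w =
      ∑ a, ∑ b, w a * (SigMat N σ (xiN N k) a b * w b) := by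
    simp only [dotProduct, Matrix.mulVec, Finset.mul_sum]
    rfl
  rw [h4, h3] at hpos
  exact lt_irrefl _ hpos

lemma hatK_zero (N : ℕ) (hN : 0 < N) (σ : V3 → ℝ) (hper : IsPerN N σ) (hreg : ContDiff ℝ 2 σ)
    (hW : WienerCond N σ) (r : V3) (κ : GammaIdx N → V3)
    (h0 : dualSum N (sigma1F N σ r κ) = 0) (k : Fin 3 → ℤ) (hk : ¬ inGamma1 N k) (a : Fin 3) :
    hatK N κ (xiN N k) a = 0 := by
  have key : ∀ m : Fin 3 → ℤ, fCoeffR N σ (xiN N (k + (N : ℤ) • m)) = 0 ∨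
      ∑ a, (xiN N (k + (N : ℤ) • m) a : ℂ) * hatK N κ (xiN N k) a = 0 := by
    intro m
    have hne : k + (N : ℤ) • m ≠ 0 := by
      intro h
      apply hk
      intro i
      have := congrFun h i
      simp only [Pi.add_apply, Pi.smul_apply, smul_eq_mul, Pi.zero_apply] at this
      exact ⟨-m i, by linarith⟩
    have h1 := coeff_zero N hN _ (sigma1F_cont N σ hreg r κ) h0 _ hne
    rw [sigma1_coeff N hN σ hper hreg] at h1
    simp only [hatK_shift N hN] at h1
    have hE : Complex.I * Ech N (k + (N : ℤ) • m) r ≠ 0 :=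
      mul_ne_zero Complex.I_ne_zero (Complex.exp_ne_zero _)
    rw [mul_assoc] at h1
    exact mul_eq_zero.1 ((mul_eq_zero.1 h1).resolve_left hE)
  have hre := wiener_zero N hN σ hreg.continuous hW k hk (fun a => (hatK N κ (xiN N k) a).re) (by
    intro m
    rcases key m with h | h
    · rw [h]; simp
    · have := congrArg Complex.re h
      simp only [Complex.re_sum, Complex.re_ofReal_mul, Complex.zero_re] at this
      rw [this, zero_mul])
  have him := wiener_zero N hN σ hreg.continuous hW k hk (fun a => (hatK N κ (xiN N k) a).im) (by
    intro m
    rcases key m with h | h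
    · rw [h]; simp
    · have := congrArg Complex.im h
      simp only [Complex.im_sum, Complex.im_ofReal_mul, Complex.zero_im] at this
      rw [this, zero_mul])
  exact Complex.ext (congrFun hre a) (congrFun him a)

lemma geom_zero (N : ℕ) (hN : 0 < N) (p q : Fin N) (hpq : p ≠ q) :
    ∑ j : Fin N, Complex.exp (Complex.I * (2 * π / N) * (j : ℕ) * (((p : ℕ) : ℂ) - ((q : ℕ) : ℂ))) = 0 := by
  have hN' : (N : ℂ) ≠ 0 := by exact_mod_cast hN.ne'
  set z : ℂ := Complex.exp (Complex.I * (2 * π / N) * (((p : ℕ) : ℂ) - ((q : ℕ) : ℂ))) with hz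
  have e : ∀ j : Fin N, Complex.exp (Complex.I * (2 * π / N) * (j : ℕ) *
      (((p : ℕ) : ℂ) - ((q : ℕ) : ℂ))) = z ^ (j : ℕ) := by
    intro j
    rw [hz, ← Complex.exp_nat_mul]
    congr 1; ring
  simp only [e]
  rw [Fin.sum_univ_eq_sum_range (fun j => z ^ j)]
  have hz1 : z ≠ 1 := by
    intro h
    rw [hz, Complex.exp_eq_one_iff] at h
    obtain ⟨n, hn⟩ := h
    have hpi : (2 * π * Complex.I : ℂ) ≠ 0 := Complex.two_pi_I_ne_zero
    have h2 : ((p : ℕ) : ℂ) - ((q : ℕ) : ℂ) = n * N := by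
      have h3 : (2 * π * Complex.I : ℂ) * (((p : ℕ) : ℂ) - ((q : ℕ) : ℂ)) =
          (2 * π * Complex.I : ℂ) * (n * N) := by
        field_simp at hn
        linear_combination Complex.I * 2 * π * hn
      exact mul_left_cancel₀ hpi h3
    have h4 : ((p : ℕ) : ℤ) - ((q : ℕ) : ℤ) = n * N := by exact_mod_cast h2
    have h5 := p.2
    have h6 := q.2
    have h7 : n = 0 := by
      have : |n * (N : ℤ)| < N := by rw [← h4, abs_lt]; constructor <;> omega
      rw [abs_mul, Nat.abs_cast] at this
      by_contra hn0
      have : 1 ≤ |n| := Int.one_le_abs hn0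
      nlinarith
    subst h7
    apply hpq
    ext
    omega
  rw [geom_sum_eq hz1]
  have : z ^ N = 1 := by
    rw [hz, ← Complex.exp_nat_mul, Complex.exp_eq_one_iff]
    refine ⟨((p : ℕ) : ℤ) - ((q : ℕ) : ℤ), ?_⟩
    push_cast
    field_simp
  rw [this]; simp

def idxZ {N : ℕ} (j : GammaIdx N) : Fin 3 → ℤ := fun i => ((j i : ℕ) : ℤ)

lemma char_orth (N : ℕ) (hN : 0 < N) (n n' : GammaIdx N) :
    ∑ j : GammaIdx N, Ech N (idxZ j) (embG n' - embG n) = if n' = n then (N : ℂ) ^ 3 else 0 := by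
  have e : ∀ j : GammaIdx N, Ech N (idxZ j) (embG n' - embG n) =
      ∏ i, Complex.exp (Complex.I * (2 * π / N) * (j i : ℕ) *
        (((n' i : ℕ) : ℂ) - ((n i : ℕ) : ℂ))) := by
    intro j
    rw [Ech_prod]
    refine Finset.prod_congr rfl fun i _ => ?_
    congr 1
    simp only [idxZ, embG, Pi.sub_apply]
    push_cast
    ring
  simp only [e]
  have h := Finset.prod_univ_sum (fun _ : Fin 3 => (Finset.univ : Finset (Fin N)))
    (fun i (j : Fin N) => Complex.exp (Complex.I * (2 * π / N) * (j : ℕ) *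
        (((n' i : ℕ) : ℂ) - ((n i : ℕ) : ℂ))))
  rw [Fintype.piFinset_univ] at h
  rw [← h]
  split_ifs with hn
  · subst hn
    simp
  · obtain ⟨i, hi⟩ := Function.ne_iff.mp hn
    exact Finset.prod_eq_zero (Finset.mem_univ i) (geom_zero N hN _ _ hi)

lemma inversion (N : ℕ) (hN : 0 < N) (κ : GammaIdx N → V3) (n : GammaIdx N) (a : Fin 3) :
    ∑ j : GammaIdx N, Ech N (idxZ j) (-embG n) * hatK N κ (xiN N (idxZ j)) a =
      (N : ℂ) ^ 3 * (κ n a : ℝ) := by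
  have e : ∀ j : GammaIdx N, Ech N (idxZ j) (-embG n) * hatK N κ (xiN N (idxZ j)) a =
      ∑ n' : GammaIdx N, Ech N (idxZ j) (embG n' - embG n) * (κ n' a : ℝ) := by
    intro j
    simp only [hatK, Finset.mul_sum]
    refine Finset.sum_congr rfl fun n' _ => ?_
    rw [sub_eq_add_neg, Ech_add]
    simp only [Ech]
    ring
  simp only [e]
  rw [Finset.sum_comm]
  simp only [← Finset.sum_mul, char_orth N hN]
  simp

/-- under the Jellium and Wiener conditions, the vanishing of
`∑_{ξ≠0}|σ̂⁽¹⁾(ξ)|²/|ξ|²` forces `κ` to be constant. -/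
theorem stmt7 (N : ℕ) (hN : 0 < N) (σ : V3 → ℝ) (e Z : ℝ) (he : 0 < e) (hZ : 0 < Z)
    (hper : IsPerN N σ) (hreg : ContDiff ℝ 2 σ)
    (hint : (∫ x in cubeN N, σ x) = e * Z)
    (hJ : JelliumCond N σ) (hW : WienerCond N σ)
    (r : V3) (κ : GammaIdx N → V3)
    (h0 : dualSum N (sigma1F N σ r κ) = 0) :
    ∃ s : V3, ∀ n : GammaIdx N, κ n = s := by
  have hN' : (N : ℂ) ≠ 0 := by exact_mod_cast hN.ne'
  have hh := hatK_zero N hN σ hper hreg hW r κ h0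
  let z : GammaIdx N := fun _ => ⟨0, hN⟩
  have key : ∀ n a, (N : ℂ) ^ 3 * (κ n a : ℝ) = hatK N κ (xiN N (idxZ z)) a := by
    intro n a
    rw [← inversion N hN κ n a, Finset.sum_eq_single z]
    · have : Ech N (idxZ z) (-embG n) = 1 := by simp [Ech, dotP, xiN, idxZ, z]
      rw [this, one_mul]
    · intro j _ hj
      rw [hh (idxZ j) _ a, mul_zero]
      intro hg
      apply hj
      ext i
      have := Int.eq_zero_of_dvd_of_nonneg_of_lt (by simp [idxZ]) (by simp [idxZ]) (hg i)
      simpa [idxZ, z] using this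
    · simp
  refine ⟨κ z, fun n => ?_⟩
  ext a
  have h1 := (key n a).trans (key z a).symm
  have h2 := mul_left_cancel₀ (pow_ne_zero 3 hN') h1
  exact_mod_cast h2

end SPN
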